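/- For every finite set ξ_L ⊂ ℝ^d with at least two points, every α > 0 and every i ∈ {1,2,3}, the mixing time is bounded in terms of the spectral profile: τ^i(L) ≤ 2·∫_{4ν^i_*}^{4e} dr / (r·Λ^i(r)). -/

import Mathlib

open MeasureTheory Filter
open scoped ENNReal

noncomputable section

abbrev Pt (d : ℕ) := EuclideanSpace ℝ (Fin d)
abbrev Config (d : ℕ) := Set (Pt d)

def IsLocallyFinite {d : ℕ} (ξ : Config d) : Prop :=
  ∀ A : Set (Pt d), Bornology.IsBounded A → (ξ ∩ A).Finite

instance configMS (d : ℕ) : MeasurableSpace (Config d) :=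
  MeasurableSpace.generateFrom
    { E | ∃ (A : Set (Pt d)) (n : ℕ), Bornology.IsBounded A ∧ MeasurableSet A ∧
        E = {ξ : Config d | (ξ ∩ A).ncard = n} }

def IsPointProcess {d : ℕ} (P : Measure (Config d)) : Prop :=
  IsProbabilityMeasure P ∧ ∀ᵐ ξ ∂P, IsLocallyFinite ξ

def cube (d : ℕ) (L : ℝ) : Set (Pt d) := {p | ∀ i, |p i| ≤ L / 2}

/-- The cube `B_x = Kx + [0,K)^d`. -/
def Kcube (d : ℕ) (K : ℝ) (x : Fin d → ℤ) : Set (Pt d) :=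
  {p | ∀ i, K * x i ≤ p i ∧ p i < K * x i + K}

/-- Bernoulli(p) i.i.d. field on `ℤ^d`, characterized by its cylinder probabilities. -/
def IsBernoulliField (d : ℕ) (p : ℝ) (ν : Measure ((Fin d → ℤ) → Bool)) : Prop :=
  IsProbabilityMeasure ν ∧
  ∀ (S : Finset (Fin d → ℤ)) (b : (Fin d → ℤ) → Bool),
    ν {ω | ∀ x ∈ S, ω x = b x} = ∏ x ∈ S, ENNReal.ofReal (if b x then p else 1 - p)

/-- Assumption (A1): for every p < 1 there is K such that the good-box field
dominates an i.i.d. Bernoulli(p) field, in the sense of a monotone coupling. -/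
def AssumptionA1 {d : ℕ} (P : Measure (Config d)) : Prop :=
  ∀ p : ℝ, 0 < p → p < 1 → ∃ K : ℝ, 0 < K ∧
    ∃ (μ : Measure (Config d × ((Fin d → ℤ) → Bool))) (ν : Measure ((Fin d → ℤ) → Bool)),
      IsProbabilityMeasure μ ∧ IsBernoulliField d p ν ∧
      μ.map Prod.fst = P ∧ μ.map Prod.snd = ν ∧
      ∀ᵐ ω ∂μ, ∀ x : Fin d → ℤ, ω.2 x = true → (ω.1 ∩ Kcube d K x).Nonempty

/-- `R_A(ξ) = Σ_{x ∈ ξ∩A} Σ_{y ∈ ξ} exp(-|x-y|^α)` (valued in `ℝ≥0∞`). -/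
def Rfun {d : ℕ} (α : ℝ) (A : Set (Pt d)) (ξ : Config d) : ℝ≥0∞ :=
  ∑' (x : ↥(ξ ∩ A)) (y : ↥ξ), ENNReal.ofReal (Real.exp (-(dist (x : Pt d) (y : Pt d)) ^ α))

/-- The cube `V_x = L^ε x + [0, L^ε)^d`. -/
def Vcube (d : ℕ) (L : ℕ) (ε : ℝ) (x : Fin d → ℤ) : Set (Pt d) :=
  {p | ∀ i, (L : ℝ) ^ ε * x i ≤ p i ∧ p i < (L : ℝ) ^ ε * x i + (L : ℝ) ^ ε}

/-- Assumption (A2). -/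
def AssumptionA2 {d : ℕ} (α : ℝ) (P : Measure (Config d)) : Prop :=
  ∀ ε : ℝ, 0 < ε → ε < 1 → ∃ C : ℝ, 0 < C ∧
    ∀ᵐ ξ ∂P, ∀ᶠ L : ℕ in atTop,
      ∀ x : Fin d → ℤ, (Vcube d L ε x ∩ cube d L).Nonempty →
        Rfun α (Vcube d L ε x) ξ ≤ ENNReal.ofReal (C * (L : ℝ) ^ (ε * d))

noncomputable instance {d : ℕ} : DecidableEq (Pt d) := Classical.decEq _

variable {d : ℕ}

/-- jump rate `e^{-|x-y|^α}`. -/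
def rate (α : ℝ) (x y : Pt d) : ℝ := Real.exp (-(dist x y) ^ α)

/-- weights `w^i_x` for the three models `i = 1,2,3`. -/
def wgt (α : ℝ) (E : Finset (Pt d)) (i : ℕ) (x : Pt d) : ℝ :=
  if i = 1 then 1
  else if i = 2 then ∑ z ∈ E.erase x, rate α x z
  else max 1 (∑ z ∈ E.erase x, rate α x z)

/-- `W^i(U) = Σ_{x∈U} w^i_x`. -/
def Wsum (α : ℝ) (E : Finset (Pt d)) (i : ℕ) (U : Finset (Pt d)) : ℝ :=
  ∑ x ∈ U, wgt α E i x

/-- the reversible probability measure `ν^i(x) = w^i_x / W^i(ξ_L)`. -/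
def nu (α : ℝ) (E : Finset (Pt d)) (i : ℕ) (x : Pt d) : ℝ :=
  wgt α E i x / Wsum α E i E

/-- conductance `I^i_U`. -/
def conduct (α : ℝ) (E : Finset (Pt d)) (i : ℕ) (U : Finset (Pt d)) : ℝ :=
  (∑ x ∈ U, ∑ y ∈ E \ U, rate α x y) / Wsum α E i U

/-- isoperimetric profile `φ^i_L(t)` (valued in `ℝ≥0∞`; `∞` if no admissible `U`). -/
def isoProfile (α : ℝ) (E : Finset (Pt d)) (i : ℕ) (t : ℝ) : ℝ≥0∞ :=
  ⨅ (U : Finset (Pt d)) (_ : U ⊆ E) (_ : U.Nonempty)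
    (_ : Wsum α E i U ≤ t * Wsum α E i E), ENNReal.ofReal (conduct α E i U)

/-- Cheeger's constant `Φ^i_L = φ^i_L(1/2)`. -/
def cheeger (α : ℝ) (E : Finset (Pt d)) (i : ℕ) : ℝ≥0∞ := isoProfile α E i (1 / 2)

/-- Dirichlet form `E_i(f)`. -/
def dirichlet (α : ℝ) (E : Finset (Pt d)) (i : ℕ) (f : Pt d → ℝ) : ℝ :=
  (1 / 2) * ∑ x ∈ E, ∑ y ∈ E.erase x,
    nu α E i x * (rate α x y / wgt α E i x) * (f x - f y) ^ 2

/-- variance `Var_i(f) = ν^i(f²) - ν^i(f)²`. -/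
def varNu (α : ℝ) (E : Finset (Pt d)) (i : ℕ) (f : Pt d → ℝ) : ℝ :=
  (∑ x ∈ E, nu α E i x * f x ^ 2) - (∑ x ∈ E, nu α E i x * f x) ^ 2

/-- nonconstant on `E`. -/
def Nonconst (E : Finset (Pt d)) (f : Pt d → ℝ) : Prop := ∃ x ∈ E, ∃ y ∈ E, f x ≠ f y

/-- Poincaré constant `γ^i(L) = sup { Var_i f / E_i f : f nonconstant }`. -/
def gammaP (α : ℝ) (E : Finset (Pt d)) (i : ℕ) : ℝ≥0∞ :=
  ⨆ (f : Pt d → ℝ) (_ : Nonconst E f),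
    ENNReal.ofReal (varNu α E i f / dirichlet α E i f)

/-- the generator `L^i` as a matrix on `E`. -/
def gen (α : ℝ) (E : Finset (Pt d)) (i : ℕ) : Matrix ↥E ↥E ℝ :=
  Matrix.of fun x y =>
    if x = y then -(∑ z ∈ E.erase (x : Pt d), rate α (x : Pt d) z / wgt α E i (x : Pt d))
    else rate α (x : Pt d) (y : Pt d) / wgt α E i (x : Pt d)

/-- heat kernel `H^i_t = exp(t L^i)`, via the exponential series. -/
def heatKernel (α : ℝ) (E : Finset (Pt d)) (i : ℕ) (t : ℝ) (x y : ↥E) : ℝ :=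
  ∑' n : ℕ, t ^ n / (n.factorial : ℝ) * (gen α E i ^ n) x y

/-- uniform mixing time `τ^i(L)` (valued in `ℝ≥0∞`). -/
def mixTime (α : ℝ) (E : Finset (Pt d)) (i : ℕ) : ℝ≥0∞ :=
  ⨅ (t : ℝ) (_ : 0 < t)
    (_ : ∀ x y : ↥E,
      |heatKernel α E i t x y - nu α E i (y : Pt d)| / nu α E i (y : Pt d) ≤ Real.exp (-1)),
    ENNReal.ofReal t

/-- `c₀⁺(U)`: nonnegative, nonconstant, vanishing outside `U`. -/
def c0plus (E U : Finset (Pt d)) (f : Pt d → ℝ) : Prop :=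
  (∀ x ∈ E, 0 ≤ f x) ∧ Nonconst E f ∧ ∀ x ∈ E, x ∉ U → f x = 0

/-- `λ^i(U) = inf { E_i f / Var_i f : f ∈ c₀⁺(U) }`. -/
def lambdaU (α : ℝ) (E : Finset (Pt d)) (i : ℕ) (U : Finset (Pt d)) : ℝ :=
  sInf {r : ℝ | ∃ f : Pt d → ℝ, c0plus E U f ∧ r = dirichlet α E i f / varNu α E i f}

/-- `ν^i_* = min_{x∈E} ν^i(x)`. -/
def nuStar (α : ℝ) (E : Finset (Pt d)) (i : ℕ) : ℝ :=
  sInf (nu α E i '' ↑E)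

/-- `ν^i(U)` for a subset `U`. -/
def nuSet (α : ℝ) (E : Finset (Pt d)) (i : ℕ) (U : Finset (Pt d)) : ℝ :=
  ∑ x ∈ U, nu α E i x

/-- spectral profile `Λ^i(r)`. -/
def specProfile (α : ℝ) (E : Finset (Pt d)) (i : ℕ) (r : ℝ) : ℝ :=
  sInf {l : ℝ | ∃ U : Finset (Pt d), U ⊆ E ∧
    nuStar α E i ≤ nuSet α E i U ∧ nuSet α E i U ≤ r ∧ l = lambdaU α E i U}

/-- hybrid conductance profile `ψ_L(t)`: model-3 conductance, counting constraint. -/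
def hybridProfile (α : ℝ) (E : Finset (Pt d)) (t : ℝ) : ℝ≥0∞ :=
  ⨅ (U : Finset (Pt d)) (_ : U ⊆ E) (_ : U.Nonempty)
    (_ : (U.card : ℝ) ≤ t * (E.card : ℝ)), ENNReal.ofReal (conduct α E 3 U)

section MatrixExponential

open scoped Matrix.Norms.Operator

variable {ι : Type*} [Fintype ι] [DecidableEq ι]

lemma hasSum_exp_smul_apply (Q : Matrix ι ι ℝ) (t : ℝ) (x y : ι) :
    HasSum (fun n : ℕ => t ^ n / (n.factorial : ℝ) * (Q ^ n) x y)
      (NormedSpace.exp (t • Q) x y) := by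
  have h : HasSum (fun n : ℕ => ((n.factorial : ℝ)⁻¹) • (t • Q) ^ n) (NormedSpace.exp (t • Q)) :=
    NormedSpace.exp_series_hasSum_exp' (𝕂 := ℝ) (t • Q)
  have h' := Pi.hasSum.1 (Pi.hasSum.1 h x) y
  refine h'.congr_fun ?_
  intro n
  simp only [smul_pow, Matrix.smul_apply, smul_eq_mul]
  ring

lemma exp_smul_apply_nonneg_of_nonneg {A : Matrix ι ι ℝ} (hA : ∀ x y, 0 ≤ A x y) {t : ℝ}
    (ht : 0 ≤ t) (x y : ι) : 0 ≤ NormedSpace.exp (t • A) x y := by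
  have hpow : ∀ n : ℕ, ∀ x y, 0 ≤ (A ^ n) x y := by
    intro n
    induction n with
    | zero => intro x y; rw [pow_zero, Matrix.one_apply]; split_ifs <;> norm_num
    | succ k ih =>
      intro x y
      rw [pow_succ, Matrix.mul_apply]
      exact Finset.sum_nonneg fun z _ => mul_nonneg (ih x z) (hA z y)
  exact (hasSum_exp_smul_apply A t x y).nonneg fun n => mul_nonneg (by positivity) (hpow n x y)

lemma exp_smul_apply_nonneg {Q : Matrix ι ι ℝ} (hQ : ∀ x y, x ≠ y → 0 ≤ Q x y) {t : ℝ}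
    (ht : 0 ≤ t) (x y : ι) : 0 ≤ NormedSpace.exp (t • Q) x y := by
  set c : ℝ := ∑ z, |Q z z| with hc
  have hshift : ∀ x y, 0 ≤ (Q + c • (1 : Matrix ι ι ℝ)) x y := by
    intro x y
    rw [Matrix.add_apply, Matrix.smul_apply, smul_eq_mul]
    by_cases hxy : x = y
    · subst hxy
      have h1 : |Q x x| ≤ c :=
        Finset.single_le_sum (f := fun z => |Q z z|) (fun z _ => abs_nonneg _) (Finset.mem_univ x)
      have h2 := neg_abs_le (Q x x)
      simp only [Matrix.one_apply_eq]
      linarith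
    · rw [Matrix.one_apply_ne hxy, mul_zero, add_zero]
      exact hQ x y hxy
  have hsplit : t • Q = (-(t * c)) • (1 : Matrix ι ι ℝ) + t • (Q + c • (1 : Matrix ι ι ℝ)) := by
    rw [smul_add, smul_smul, neg_smul]; abel
  have hscalar : NormedSpace.exp ((-(t * c)) • (1 : Matrix ι ι ℝ))
      = Real.exp (-(t * c)) • (1 : Matrix ι ι ℝ) := by
    rw [← Algebra.algebraMap_eq_smul_one, ← Algebra.algebraMap_eq_smul_one, Real.exp_eq_exp_ℝ]
    exact (NormedSpace.algebraMap_exp_comm (𝕂 := ℝ) _).symm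
  rw [hsplit, Matrix.exp_add_of_commute _ _ ((Commute.one_left _).smul_left _), hscalar,
    smul_mul_assoc, one_mul, Matrix.smul_apply, smul_eq_mul]
  exact mul_nonneg (Real.exp_pos _).le (exp_smul_apply_nonneg_of_nonneg hshift ht x y)

lemma exp_smul_apply_reversible {Q : Matrix ι ι ℝ} {π : ι → ℝ}
    (hrev : ∀ x y, π x * Q x y = π y * Q y x) (t : ℝ) (x y : ι) :
    π x * NormedSpace.exp (t • Q) x y = π y * NormedSpace.exp (t • Q) y x := by
  have hpow : ∀ n : ℕ, ∀ x y, π x * (Q ^ n) x y = π y * (Q ^ n) y x := by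
    intro n
    induction n with
    | zero =>
      intro x y
      by_cases hxy : x = y
      · rw [hxy]
      · simp [Matrix.one_apply_ne hxy, Matrix.one_apply_ne (Ne.symm hxy)]
    | succ k ih =>
      intro x y
      rw [pow_succ, Matrix.mul_apply, ← pow_succ, pow_succ', Matrix.mul_apply, Finset.mul_sum,
        Finset.mul_sum]
      refine Finset.sum_congr rfl fun z _ => ?_
      linear_combination Q z y * ih x z + (Q ^ k) z x * hrev z y
  have h1 := (hasSum_exp_smul_apply Q t x y).mul_left (π x)
  have h2 := (hasSum_exp_smul_apply Q t y x).mul_left (π y)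
  refine h1.unique (h2.congr_fun fun n => ?_)
  linear_combination (t ^ n / (n.factorial : ℝ)) * hpow n x y

lemma sum_exp_smul_apply {Q : Matrix ι ι ℝ} (hQ : ∀ x, ∑ y, Q x y = 0) (t : ℝ) (x : ι) :
    ∑ y, NormedSpace.exp (t • Q) x y = 1 := by
  have h1 := hasSum_sum (s := Finset.univ) fun y _ => hasSum_exp_smul_apply Q t x y
  have h2 : HasSum (fun n : ℕ => ∑ y, t ^ n / (n.factorial : ℝ) * (Q ^ n) x y) 1 := by
    have : ∀ n : ℕ, n ≠ 0 → ∑ y, t ^ n / (n.factorial : ℝ) * (Q ^ n) x y = 0 := by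
      intro n hn
      obtain ⟨k, rfl⟩ := Nat.exists_eq_succ_of_ne_zero hn
      rw [← Finset.mul_sum]
      simp only [Nat.succ_eq_add_one, pow_succ Q, Matrix.mul_apply]
      rw [Finset.sum_comm]
      simp [← Finset.mul_sum, hQ]
    have h := hasSum_single 0 this
    simpa [Matrix.one_apply] using h
  exact h1.unique h2

lemma hasDerivAt_exp_smul_apply (Q : Matrix ι ι ℝ) (t : ℝ) (x y : ι) :
    HasDerivAt (fun s : ℝ => NormedSpace.exp (s • Q) x y)
      (∑ z, NormedSpace.exp (t • Q) x z * Q z y) t := by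
  have h := hasDerivAt_exp_smul_const (𝕂 := ℝ) Q t
  exact hasDerivAt_pi.1 (hasDerivAt_pi.1 h x) y

lemma exp_add_smul_apply (Q : Matrix ι ι ℝ) (s t : ℝ) (x y : ι) :
    NormedSpace.exp ((s + t) • Q) x y
      = ∑ z, NormedSpace.exp (s • Q) x z * NormedSpace.exp (t • Q) z y := by
  rw [add_smul, Matrix.exp_add_of_commute _ _ (((Commute.refl Q).smul_left s).smul_right t),
    Matrix.mul_apply]

end MatrixExponential

/-- If `I` decays at rate at least `Λ (4 / I)` and `I 0 ≤ 4 / a`, then `I ≤ 4 / b` at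
time `∫ r in a..b, 1 / (r * Λ r)`. -/
lemma le_of_deriv_le_neg_mul_profile {I I' Λ : ℝ → ℝ} {a b : ℝ} (ha : 0 < a) (hab : a < b)
    (hI : ∀ t, HasDerivAt I (I' t) t) (hI0 : I 0 ≤ 4 / a) (hanti : ∀ t, 0 ≤ t → I' t ≤ 0)
    (hdec : ∀ t, 0 ≤ t → 0 < I t → I' t ≤ -(I t * Λ (4 / I t)))
    (hΛ : ∀ r, a ≤ r → 0 < Λ r)
    (hint : IntervalIntegrable (fun r => 1 / (r * Λ r)) volume a b) :
    I (∫ r in a..b, 1 / (r * Λ r)) ≤ 4 / b := by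
  set g : ℝ → ℝ := fun r => 1 / (r * Λ r) with hg
  have hgpos : ∀ r, a ≤ r → 0 < g r := fun r hr =>
    one_div_pos.2 (mul_pos (ha.trans_le hr) (hΛ r hr))
  set T := ∫ r in a..b, g r with hT
  have hTpos : 0 < T :=
    intervalIntegral.intervalIntegral_pos_of_pos_on hint (fun r hr => hgpos r hr.1.le) hab
  by_contra! hcon
  have hb : 0 < b := ha.trans hab
  have hIanti : AntitoneOn I (Set.Ici 0) := by
    refine antitoneOn_of_deriv_nonpos (convex_Ici 0)
      (fun t _ => (hI t).continuousAt.continuousWithinAt)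
      (fun t _ => (hI t).differentiableAt.differentiableWithinAt) fun t ht => ?_
    rw [interior_Ici] at ht
    rw [(hI t).deriv]
    exact hanti t (le_of_lt ht)
  have hIpos : ∀ t ∈ Set.Icc 0 T, 4 / b < I t := fun t ht =>
    hcon.trans_le (hIanti ht.1 hTpos.le ht.2)
  have hIpos' : ∀ t ∈ Set.Icc 0 T, 0 < I t := fun t ht =>
    (by positivity : 0 < 4 / b).trans (hIpos t ht)
  have hIle : ∀ t ∈ Set.Icc 0 T, I t ≤ 4 / a := fun t ht =>
    (hIanti (Set.mem_Ici.2 le_rfl) ht.1 ht.1).trans hI0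
  set v : ℝ → ℝ := fun t => 4 / I t with hv
  have hva : ∀ t ∈ Set.Icc 0 T, a ≤ v t := fun t ht => by
    have h1 := hIpos' t ht
    have h2 := hIle t ht
    rw [le_div_iff₀ ha] at h2
    rw [hv, le_div_iff₀ h1]; linarith
  have hvb : v T < b := by
    have hm : T ∈ Set.Icc 0 T := ⟨hTpos.le, le_rfl⟩
    have h1 := hIpos' T hm
    have h2 := hIpos T hm
    rw [div_lt_iff₀ hb] at h2
    rw [hv, div_lt_iff₀ h1]; linarith
  have hvT : a ≤ v T := hva T ⟨hTpos.le, le_rfl⟩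
  have hvd : ∀ t ∈ Set.Icc 0 T, HasDerivWithinAt v (-(4 * I' t) / I t ^ 2) (Set.Icc 0 T) t := by
    intro t ht
    have h : HasDerivWithinAt v ((0 * I t - 4 * I' t) / I t ^ 2) (Set.Icc 0 T) t :=
      ((hasDerivAt_const t (4 : ℝ)).div (hI t) (hIpos' t ht).ne').hasDerivWithinAt
    simpa using h
  have hvmono : MonotoneOn v (Set.Icc 0 T) := fun s hs t ht hst =>
    div_le_div_of_nonneg_left (by norm_num) (hIpos' t ht) (hIanti hs.1 ht.1 hst)
  have himage : v '' Set.Icc 0 T ⊆ Set.Icc a (v T) := by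
    rintro _ ⟨t, ht, rfl⟩
    exact ⟨hva t ht, hvmono ht ⟨hTpos.le, le_rfl⟩ ht.2⟩
  have hcov := lintegral_image_eq_lintegral_deriv_mul_of_monotoneOn measurableSet_Icc hvd hvmono
    (fun r => ENNReal.ofReal (g r))
  have hlow : ENNReal.ofReal T ≤ ∫⁻ t in Set.Icc 0 T,
      ENNReal.ofReal (-(4 * I' t) / I t ^ 2) * ENNReal.ofReal (g (v t)) := by
    calc ENNReal.ofReal T = ∫⁻ _ in Set.Icc 0 T, 1 := by simp
      _ ≤ _ := by
        refine setLIntegral_mono' measurableSet_Icc fun t ht => ?_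
        have h1 := hIpos' t ht
        have h2 := hdec t ht.1 h1
        have h3 := hΛ _ (hva t ht)
        have h4 : 0 ≤ -(4 * I' t) / I t ^ 2 := by
          have := hanti t ht.1
          apply div_nonneg _ (sq_nonneg _); linarith
        rw [← ENNReal.ofReal_mul h4, ENNReal.one_le_ofReal]
        have h5 : -(4 * I' t) / I t ^ 2 * g (v t) = -I' t / (I t * Λ (v t)) := by
          simp only [hg, hv] at h3 ⊢
          field_simp
        rw [h5, le_div_iff₀ (mul_pos h1 h3)]
        simp only [hv]; linarith
  have hintv : IntervalIntegrable g volume a (v T) :=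
    hint.mono_set (by
      rw [Set.uIcc_of_le hvT, Set.uIcc_of_le hab.le]; exact Set.Icc_subset_Icc_right hvb.le)
  have hintv' : IntervalIntegrable g volume (v T) b :=
    hint.mono_set (by
      rw [Set.uIcc_of_le hvb.le, Set.uIcc_of_le hab.le]; exact Set.Icc_subset_Icc_left hvT)
  have hup : ∫⁻ r in v '' Set.Icc 0 T, ENNReal.ofReal (g r)
      ≤ ENNReal.ofReal (∫ r in a..v T, g r) := by
    rw [intervalIntegral.integral_of_le hvT, ← integral_Icc_eq_integral_Ioc,
      ofReal_integral_eq_lintegral_ofReal]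
    · exact lintegral_mono_set himage
    · rw [← IntegrableOn, integrableOn_Icc_iff_integrableOn_Ioc]
      exact (intervalIntegrable_iff_integrableOn_Ioc_of_le hvT).1 hintv
    · refine (ae_restrict_iff' measurableSet_Icc).2 (Eventually.of_forall fun r hr => ?_)
      exact (hgpos r hr.1).le
  have hsplit := intervalIntegral.integral_add_adjacent_intervals hintv hintv'
  have hrest : 0 < ∫ r in v T..b, g r :=
    intervalIntegral.intervalIntegral_pos_of_pos_on hintv'
      (fun r hr => hgpos r (hvT.trans hr.1.le)) hvb
  have hfin := hlow.trans (hcov ▸ hup)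
  rw [ENNReal.ofReal_le_ofReal_iff
    (intervalIntegral.integral_nonneg hvT fun r hr => (hgpos r hr.1).le)] at hfin
  linarith

section ReversibleChain

variable {ι : Type*} [Fintype ι] {Q : Matrix ι ι ℝ} {π : ι → ℝ}

lemma sum_mul_generator_eq_neg_dirichlet (hQ : ∀ x, ∑ y, Q x y = 0)
    (hrev : ∀ x y, π x * Q x y = π y * Q y x) (f : ι → ℝ) :
    ∑ x, π x * (f x * ∑ y, Q x y * f y)
      = -((1 / 2) * ∑ x, ∑ y, π x * Q x y * (f x - f y) ^ 2) := by
  have h1 : ∑ x, ∑ y, π x * Q x y * f x ^ 2 = 0 := by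
    refine Finset.sum_eq_zero fun x _ => ?_
    rw [← Finset.sum_mul, ← Finset.mul_sum, hQ x]; ring
  have h2 : ∑ x, ∑ y, π x * Q x y * f y ^ 2 = 0 := by
    rw [Finset.sum_comm, ← h1]
    exact Finset.sum_congr rfl fun x _ => Finset.sum_congr rfl fun y _ => by rw [hrev y x]
  have h3 : ∑ x, ∑ y, π x * Q x y * (f x - f y) ^ 2
      = ∑ x, ∑ y, π x * Q x y * f x ^ 2 + ∑ x, ∑ y, π x * Q x y * f y ^ 2
        - 2 * ∑ x, π x * (f x * ∑ y, Q x y * f y) := by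
    simp only [Finset.mul_sum, ← Finset.sum_add_distrib, ← Finset.sum_sub_distrib]
    exact Finset.sum_congr rfl fun x _ => Finset.sum_congr rfl fun y _ => by ring
  rw [h3, h1, h2]; ring

variable [DecidableEq ι]

/-- The `L²(π)` variance of the heat kernel density `exp(tQ)(x, ·)/π`. -/
def densityVar (Q : Matrix ι ι ℝ) (π : ι → ℝ) (x : ι) (t : ℝ) : ℝ :=
  ∑ y, π y * (NormedSpace.exp (t • Q) x y / π y) ^ 2 - 1

lemma hasDerivAt_densityVar (hπ : ∀ x, 0 < π x) (hQ : ∀ x, ∑ y, Q x y = 0)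
    (hrev : ∀ x y, π x * Q x y = π y * Q y x) (x : ι) (t : ℝ) :
    HasDerivAt (densityVar Q π x)
      (-∑ y, ∑ z, π y * Q y z *
        (NormedSpace.exp (t • Q) x y / π y - NormedSpace.exp (t • Q) x z / π z) ^ 2) t := by
  set f : ι → ℝ := fun y => NormedSpace.exp (t • Q) x y / π y with hf
  have hgen : ∀ y, (∑ z, NormedSpace.exp (t • Q) x z * Q z y) / π y = ∑ z, Q y z * f z := by
    intro y
    rw [Finset.sum_div]
    refine Finset.sum_congr rfl fun z _ => ?_
    have h1 := (hπ y).ne'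
    have h2 := (hπ z).ne'
    simp only [hf]
    field_simp
    linear_combination NormedSpace.exp (t • Q) x z * hrev z y
  have hsum : HasDerivAt (densityVar Q π x)
      (∑ y, π y * (2 * f y * ∑ z, Q y z * f z)) t := by
    refine (HasDerivAt.fun_sum fun y _ => ?_).sub_const 1
    have h := (((hasDerivAt_exp_smul_apply Q t x y).div_const (π y)).pow 2).const_mul (π y)
    rw [hgen y] at h
    simpa using h
  convert hsum using 1
  have h := sum_mul_generator_eq_neg_dirichlet hQ hrev f
  have h' : ∑ y, π y * (2 * f y * ∑ z, Q y z * f z)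
      = 2 * ∑ y, π y * (f y * ∑ z, Q y z * f z) := by
    rw [Finset.mul_sum]
    exact Finset.sum_congr rfl fun y _ => by ring
  rw [h', h]; ring

lemma densityVar_zero (hπ : ∀ x, 0 < π x) (x : ι) : densityVar Q π x 0 = 1 / π x - 1 := by
  have h : ∀ y, π y * (NormedSpace.exp ((0 : ℝ) • Q) x y / π y) ^ 2
      = if x = y then 1 / π x else 0 := by
    intro y
    rw [zero_smul, NormedSpace.exp_zero, Matrix.one_apply]
    split_ifs with hxy
    · subst hxy
      have := (hπ x).ne'
      field_simp
    · simp
  rw [densityVar, Finset.sum_congr rfl fun y _ => h y]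
  simp

lemma abs_exp_add_self_sub_div_le (hπ : ∀ x, 0 < π x) (hsum : ∑ x, π x = 1)
    (hQ : ∀ x, ∑ y, Q x y = 0) (hrev : ∀ x y, π x * Q x y = π y * Q y x) {t c : ℝ}
    (hc : 0 ≤ c) (hvar : ∀ x, densityVar Q π x t ≤ c) (x y : ι) :
    |NormedSpace.exp ((t + t) • Q) x y - π y| / π y ≤ c := by
  set f : ι → ι → ℝ := fun u z => NormedSpace.exp (t • Q) u z / π z with hf
  have hmean : ∀ u, ∑ z, π z * f u z = 1 := by
    intro u
    rw [← sum_exp_smul_apply hQ t u]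
    exact Finset.sum_congr rfl fun z _ => mul_div_cancel₀ _ (hπ z).ne'
  have hvar' : ∀ u, ∑ z, (√(π z) * (f u z - 1)) ^ 2 ≤ c := by
    intro u
    have h : ∑ z, (√(π z) * (f u z - 1)) ^ 2
        = ∑ z, π z * f u z ^ 2 - 2 * ∑ z, π z * f u z + ∑ z, π z := by
      rw [Finset.mul_sum, ← Finset.sum_sub_distrib, ← Finset.sum_add_distrib]
      refine Finset.sum_congr rfl fun z _ => ?_
      rw [mul_pow, Real.sq_sqrt (hπ z).le]; ring
    rw [h, hmean u, hsum]
    have := hvar u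
    rw [densityVar] at this
    simp only [hf]
    linarith
  have hker : (NormedSpace.exp ((t + t) • Q) x y - π y) / π y
      = ∑ z, (√(π z) * (f x z - 1)) * (√(π z) * (f y z - 1)) := by
    have h : ∑ z, (√(π z) * (f x z - 1)) * (√(π z) * (f y z - 1))
        = ∑ z, π z * (f x z * f y z) - ∑ z, π z * f x z - ∑ z, π z * f y z + ∑ z, π z := by
      rw [← Finset.sum_sub_distrib, ← Finset.sum_sub_distrib, ← Finset.sum_add_distrib]
      refine Finset.sum_congr rfl fun z _ => ?_
      rw [mul_mul_mul_comm, Real.mul_self_sqrt (hπ z).le]; ring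
    rw [h, hmean, hmean, hsum, sub_div, div_self (hπ y).ne', exp_add_smul_apply, Finset.sum_div]
    have h' : ∀ z, NormedSpace.exp (t • Q) x z * NormedSpace.exp (t • Q) z y / π y
        = π z * (f x z * f y z) := by
      intro z
      have h1 := (hπ y).ne'
      have h2 := (hπ z).ne'
      simp only [hf]
      field_simp
      linear_combination NormedSpace.exp (t • Q) x z * exp_smul_apply_reversible hrev t z y
    rw [Finset.sum_congr rfl fun z _ => h' z]; ring
  rw [← abs_of_pos (hπ y), ← abs_div, abs_of_pos (hπ y), hker]
  refine abs_le_of_sq_le_sq ?_ hc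
  refine (Finset.sum_mul_sq_le_sq_mul_sq _ _ _).trans ?_
  rw [sq]
  exact mul_le_mul (hvar' x) (hvar' y) (Finset.sum_nonneg fun z _ => sq_nonneg _) hc

/-- Mixing bound from a profile inequality `Λ(4 / Var f) Var f ≤ 2 E(f)` for densities `f`. -/
lemma abs_exp_profile_time_sub_div_le (hπ : ∀ x, 0 < π x) (hsum : ∑ x, π x = 1)
    (hnn : ∀ x y, x ≠ y → 0 ≤ Q x y) (hQ : ∀ x, ∑ y, Q x y = 0)
    (hrev : ∀ x y, π x * Q x y = π y * Q y x) {Λ : ℝ → ℝ} {p b : ℝ} (hp : 0 < p)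
    (hpπ : ∀ x, p ≤ π x) (hb : 4 * p < b) (hΛ : ∀ r, 4 * p ≤ r → 0 < Λ r)
    (hint : IntervalIntegrable (fun r => 1 / (r * Λ r)) volume (4 * p) b)
    (hprofile : ∀ f : ι → ℝ, (∀ x, 0 ≤ f x) → ∑ x, π x * f x = 1 →
      0 < ∑ x, π x * f x ^ 2 - 1 →
      (∑ x, π x * f x ^ 2 - 1) * Λ (4 / (∑ x, π x * f x ^ 2 - 1))
        ≤ ∑ x, ∑ y, π x * Q x y * (f x - f y) ^ 2) (x y : ι) :
    |NormedSpace.exp ((2 * ∫ r in (4 * p)..b, 1 / (r * Λ r)) • Q) x y - π y| / π y ≤ 4 / b := by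
  have hb0 : 0 < b := by linarith
  rw [two_mul]
  refine abs_exp_add_self_sub_div_le hπ hsum hQ hrev (by positivity) (fun u => ?_) x y
  refine le_of_deriv_le_neg_mul_profile (by linarith) hb
    (hasDerivAt_densityVar hπ hQ hrev u) ?_ ?_ ?_ hΛ hint
  · rw [densityVar_zero hπ, div_mul_cancel_left₀ four_ne_zero, ← one_div]
    have := one_div_le_one_div_of_le hp (hpπ u)
    linarith
  · intro t _
    rw [neg_nonpos]
    refine Finset.sum_nonneg fun y _ => Finset.sum_nonneg fun z _ => ?_
    by_cases hyz : y = z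
    · simp [hyz]
    · exact mul_nonneg (mul_nonneg (hπ y).le (hnn y z hyz)) (sq_nonneg _)
  · intro t ht hpos
    rw [neg_le_neg_iff]
    refine hprofile (fun y => NormedSpace.exp (t • Q) u y / π y)
      (fun y => div_nonneg (exp_smul_apply_nonneg hnn ht u y) (hπ y).le) ?_ hpos
    rw [← sum_exp_smul_apply hQ t u]
    exact Finset.sum_congr rfl fun z _ => mul_div_cancel₀ _ (hπ z).ne'

end ReversibleChain

section RandomWalk

variable {E : Finset (Pt d)} {α : ℝ} {i : ℕ}

lemma rate_pos (α : ℝ) (x y : Pt d) : 0 < rate α x y := Real.exp_pos _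

lemma rate_comm (α : ℝ) (x y : Pt d) : rate α x y = rate α y x := by
  rw [rate, rate, dist_comm]

lemma wgt_pos (hE : 2 ≤ E.card) (α : ℝ) (i : ℕ) {x : Pt d} (hx : x ∈ E) :
    0 < wgt α E i x := by
  rw [wgt]
  split_ifs
  · exact one_pos
  · refine Finset.sum_pos (fun z _ => rate_pos α x z) (Finset.card_pos.1 ?_)
    rw [Finset.card_erase_of_mem hx]; omega
  · exact lt_max_of_lt_left one_pos

lemma Wsum_pos (hE : 2 ≤ E.card) (α : ℝ) (i : ℕ) : 0 < Wsum α E i E :=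
  Finset.sum_pos (fun _ hx => wgt_pos hE α i hx) (Finset.card_pos.1 (by omega))

lemma nu_pos (hE : 2 ≤ E.card) (α : ℝ) (i : ℕ) {x : Pt d} (hx : x ∈ E) : 0 < nu α E i x :=
  div_pos (wgt_pos hE α i hx) (Wsum_pos hE α i)

lemma sum_nu (hE : 2 ≤ E.card) (α : ℝ) (i : ℕ) : ∑ x ∈ E, nu α E i x = 1 := by
  simp only [nu]
  rw [← Finset.sum_div]
  exact div_self (Wsum_pos hE α i).ne'

lemma nu_mul_rate_div_wgt (hE : 2 ≤ E.card) {x : Pt d} (hx : x ∈ E) (y : Pt d) :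
    nu α E i x * (rate α x y / wgt α E i x) = rate α x y / Wsum α E i E := by
  have h1 := (wgt_pos hE α i hx).ne'
  rw [nu]
  field_simp

lemma nuStar_le_nu {x : Pt d} (hx : x ∈ E) : nuStar α E i ≤ nu α E i x :=
  csInf_le (E.finite_toSet.image _).bddBelow ⟨x, hx, rfl⟩

lemma exists_nu_eq_nuStar (hE : 2 ≤ E.card) (α : ℝ) (i : ℕ) :
    ∃ x ∈ E, nu α E i x = nuStar α E i := by
  have hne : (E : Set (Pt d)).Nonempty := Finset.coe_nonempty.2 (Finset.card_pos.1 (by omega))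
  obtain ⟨x, hx, h⟩ := (hne.image (nu α E i)).csInf_mem (E.finite_toSet.image _)
  exact ⟨x, hx, h⟩

lemma nuStar_pos (hE : 2 ≤ E.card) (α : ℝ) (i : ℕ) : 0 < nuStar α E i := by
  obtain ⟨x, hx, h⟩ := exists_nu_eq_nuStar hE α i
  exact h ▸ nu_pos hE α i hx

lemma nuStar_le_one (hE : 2 ≤ E.card) (α : ℝ) (i : ℕ) : nuStar α E i ≤ 1 := by
  obtain ⟨x, hx, h⟩ := exists_nu_eq_nuStar hE α i
  rw [← h, ← sum_nu hE α i]
  exact Finset.single_le_sum (fun y hy => (nu_pos hE α i hy).le) hx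

lemma nuStar_le_nuSet (hE : 2 ≤ E.card) {U : Finset (Pt d)} (hU : U ⊆ E) (hne : U.Nonempty) :
    nuStar α E i ≤ nuSet α E i U := by
  obtain ⟨x, hx⟩ := hne
  exact (nuStar_le_nu (hU hx)).trans
    (Finset.single_le_sum (fun y hy => (nu_pos hE α i (hU hy)).le) hx)

lemma dirichlet_eq (hE : 2 ≤ E.card) (f : Pt d → ℝ) :
    dirichlet α E i f
      = (1 / 2) * ∑ x ∈ E, ∑ y ∈ E, rate α x y / Wsum α E i E * (f x - f y) ^ 2 := by
  rw [dirichlet]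
  congr 1
  refine Finset.sum_congr rfl fun x hx => ?_
  rw [← Finset.sum_erase (a := x) E (by simp)]
  exact Finset.sum_congr rfl fun y _ => by rw [nu_mul_rate_div_wgt hE hx]

lemma varNu_eq (hE : 2 ≤ E.card) (f : Pt d → ℝ) :
    varNu α E i f
      = (1 / 2) * ∑ x ∈ E, ∑ y ∈ E, nu α E i x * nu α E i y * (f x - f y) ^ 2 := by
  have h : ∑ x ∈ E, ∑ y ∈ E, nu α E i x * nu α E i y * (f x - f y) ^ 2
      = (∑ x ∈ E, nu α E i x * f x ^ 2) * (∑ y ∈ E, nu α E i y)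
        + (∑ x ∈ E, nu α E i x) * (∑ y ∈ E, nu α E i y * f y ^ 2)
        - 2 * ((∑ x ∈ E, nu α E i x * f x) * (∑ y ∈ E, nu α E i y * f y)) := by
    rw [Finset.sum_mul_sum, Finset.sum_mul_sum, Finset.sum_mul_sum]
    simp only [Finset.mul_sum, ← Finset.sum_add_distrib, ← Finset.sum_sub_distrib]
    exact Finset.sum_congr rfl fun x _ => Finset.sum_congr rfl fun y _ => by ring
  rw [h, sum_nu hE, varNu]; ring

lemma dirichlet_nonneg (hE : 2 ≤ E.card) (f : Pt d → ℝ) : 0 ≤ dirichlet α E i f := by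
  rw [dirichlet_eq hE]
  have := Wsum_pos hE α i
  refine mul_nonneg (by norm_num) (Finset.sum_nonneg fun x _ => Finset.sum_nonneg fun y _ => ?_)
  have := rate_pos α x y
  positivity

lemma varNu_pos (hE : 2 ≤ E.card) {f : Pt d → ℝ} (hf : Nonconst E f) : 0 < varNu α E i f := by
  rw [varNu_eq hE]
  obtain ⟨x, hx, y, hy, hxy⟩ := hf
  have hnn : ∀ x ∈ E, ∀ y ∈ E, 0 ≤ nu α E i x * nu α E i y * (f x - f y) ^ 2 :=
    fun x hx y hy => mul_nonneg (mul_pos (nu_pos hE α i hx) (nu_pos hE α i hy)).le (sq_nonneg _)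
  refine mul_pos (by norm_num) (Finset.sum_pos' (fun x hx => Finset.sum_nonneg (hnn x hx))
    ⟨x, hx, Finset.sum_pos' (hnn x hx) ⟨y, hy, ?_⟩⟩)
  exact mul_pos (mul_pos (nu_pos hE α i hx) (nu_pos hE α i hy))
    (sq_pos_of_ne_zero (sub_ne_zero.2 hxy))

lemma varNu_eq_zero (hE : 2 ≤ E.card) {f : Pt d → ℝ} (hf : ¬Nonconst E f) :
    varNu α E i f = 0 := by
  rw [varNu_eq hE, Finset.sum_eq_zero, mul_zero]
  refine fun x hx => Finset.sum_eq_zero fun y hy => ?_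
  have : f x = f y := by
    by_contra h
    exact hf ⟨x, hx, y, hy, h⟩
  rw [this]; ring

/-- Poincaré inequality. -/
lemma exists_mul_varNu_le_dirichlet (hE : 2 ≤ E.card) (α : ℝ) (i : ℕ) :
    ∃ c : ℝ, 0 < c ∧ ∀ f, c * varNu α E i f ≤ dirichlet α E i f := by
  have hne : E.Nonempty := Finset.card_pos.1 (by omega)
  have hW := Wsum_pos hE α i
  obtain ⟨p, hp, hmin⟩ := Finset.exists_min_image (E ×ˢ E)
    (fun p => rate α p.1 p.2 / Wsum α E i E / (nu α E i p.1 * nu α E i p.2)) (hne.product hne)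
  rw [Finset.mem_product] at hp
  refine ⟨_, div_pos (div_pos (rate_pos α p.1 p.2) hW)
    (mul_pos (nu_pos hE α i hp.1) (nu_pos hE α i hp.2)), fun f => ?_⟩
  rw [varNu_eq hE, dirichlet_eq hE, mul_left_comm]
  refine mul_le_mul_of_nonneg_left ?_ (by norm_num)
  rw [Finset.mul_sum]
  refine Finset.sum_le_sum fun x hx => ?_
  rw [Finset.mul_sum]
  refine Finset.sum_le_sum fun y hy => ?_
  rw [← mul_assoc]
  refine mul_le_mul_of_nonneg_right ?_ (sq_nonneg _)
  rw [← le_div_iff₀ (mul_pos (nu_pos hE α i hx) (nu_pos hE α i hy))]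
  exact hmin (x, y) (Finset.mem_product.2 ⟨hx, hy⟩)

lemma lambdaU_le (hE : 2 ≤ E.card) {U : Finset (Pt d)} {f : Pt d → ℝ} (hf : c0plus E U f) :
    lambdaU α E i U ≤ dirichlet α E i f / varNu α E i f := by
  refine csInf_le ⟨0, ?_⟩ ⟨f, hf, rfl⟩
  rintro _ ⟨g, hg, rfl⟩
  exact div_nonneg (dirichlet_nonneg hE g) (varNu_pos hE hg.2.1).le

lemma le_lambdaU (hE : 2 ≤ E.card) {c : ℝ}
    (hc : ∀ f, c * varNu α E i f ≤ dirichlet α E i f) {U : Finset (Pt d)} (hU : U ⊆ E)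
    (hne : U.Nonempty) : c ≤ lambdaU α E i U := by
  refine le_csInf ?_ ?_
  · obtain ⟨x, hx⟩ := hne
    obtain ⟨y, hy, hyx⟩ := Finset.exists_mem_ne (by omega : 1 < E.card) x
    refine ⟨_, fun z => if z = x then 1 else 0, ⟨fun z _ => ?_, ⟨x, hU hx, y, hy, ?_⟩, ?_⟩, rfl⟩
    · positivity
    · simp [hyx]
    · intro z _ hz
      refine if_neg ?_
      rintro rfl
      exact hz hx
  · rintro _ ⟨f, hf, rfl⟩
    rw [le_div_iff₀ (varNu_pos hE hf.2.1)]
    exact hc f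

lemma nonempty_of_nuStar_le (hE : 2 ≤ E.card) {U : Finset (Pt d)}
    (hU : nuStar α E i ≤ nuSet α E i U) : U.Nonempty := by
  rw [Finset.nonempty_iff_ne_empty]
  rintro rfl
  have := nuStar_pos hE α i
  rw [nuSet, Finset.sum_empty] at hU
  linarith

lemma bddBelow_specProfile_set (hE : 2 ≤ E.card) (r : ℝ) :
    BddBelow {l : ℝ | ∃ U : Finset (Pt d), U ⊆ E ∧
      nuStar α E i ≤ nuSet α E i U ∧ nuSet α E i U ≤ r ∧ l = lambdaU α E i U} := by
  refine ⟨0, ?_⟩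
  rintro _ ⟨U, hU, h1, -, rfl⟩
  exact le_lambdaU hE (fun f => by simpa using dirichlet_nonneg hE f) hU
    (nonempty_of_nuStar_le hE h1)

lemma nonempty_specProfile_set (hE : 2 ≤ E.card) {r : ℝ} (hr : nuStar α E i ≤ r) :
    {l : ℝ | ∃ U : Finset (Pt d), U ⊆ E ∧
      nuStar α E i ≤ nuSet α E i U ∧ nuSet α E i U ≤ r ∧ l = lambdaU α E i U}.Nonempty := by
  obtain ⟨x, hx, h⟩ := exists_nu_eq_nuStar hE α i
  have hs : nuSet α E i {x} = nuStar α E i := by rw [nuSet, Finset.sum_singleton, h]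
  exact ⟨_, {x}, Finset.singleton_subset_iff.2 hx, hs.ge, hs.trans_le hr, rfl⟩

lemma le_specProfile (hE : 2 ≤ E.card) {c : ℝ}
    (hc : ∀ f, c * varNu α E i f ≤ dirichlet α E i f) {r : ℝ} (hr : nuStar α E i ≤ r) :
    c ≤ specProfile α E i r := by
  refine le_csInf (nonempty_specProfile_set hE hr) ?_
  rintro _ ⟨U, hU, h1, -, rfl⟩
  exact le_lambdaU hE hc hU (nonempty_of_nuStar_le hE h1)

lemma specProfile_pos (hE : 2 ≤ E.card) {r : ℝ} (hr : nuStar α E i ≤ r) :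
    0 < specProfile α E i r := by
  obtain ⟨c, hc0, hc⟩ := exists_mul_varNu_le_dirichlet hE α i
  exact hc0.trans_le (le_specProfile hE hc hr)

lemma antitoneOn_specProfile (hE : 2 ≤ E.card) :
    AntitoneOn (specProfile α E i) (Set.Ici (nuStar α E i)) := by
  intro r hr s _ hrs
  refine csInf_le_csInf (bddBelow_specProfile_set hE s) (nonempty_specProfile_set hE hr) ?_
  rintro _ ⟨U, hU, h1, h2, rfl⟩
  exact ⟨U, hU, h1, h2.trans hrs, rfl⟩

lemma intervalIntegrable_inv_mul_specProfile (hE : 2 ≤ E.card) {a b : ℝ}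
    (ha : nuStar α E i ≤ a) (hab : a ≤ b) :
    IntervalIntegrable (fun r => 1 / (r * specProfile α E i r)) volume a b := by
  have hν := nuStar_pos hE α i
  have hmono : MonotoneOn (fun r => (specProfile α E i r)⁻¹) (Set.uIcc a b) := by
    rw [Set.uIcc_of_le hab]
    intro r hr s hs hrs
    exact inv_anti₀ (specProfile_pos hE (ha.trans hs.1))
      (antitoneOn_specProfile hE (ha.trans hr.1) (ha.trans hs.1) hrs)
  have hcont : ContinuousOn (fun r : ℝ => r⁻¹) (Set.uIcc a b) := by
    rw [Set.uIcc_of_le hab]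
    exact continuousOn_inv₀.mono fun r hr => (hν.trans_le (ha.trans hr.1)).ne'
  have h := hmono.intervalIntegrable (μ := volume) |>.continuousOn_mul hcont
  refine h.congr ?_
  exact fun r _ => by simp [mul_comm]

/-- Truncating a density `f` at level `Var f / 4` bounds its Dirichlet form from below by the
spectral profile at `4 / Var f`. -/
lemma varNu_mul_specProfile_le (hE : 2 ≤ E.card) {f : Pt d → ℝ} (hf : ∀ x ∈ E, 0 ≤ f x)
    (hmean : ∑ x ∈ E, nu α E i x * f x = 1) (hvar : 0 < varNu α E i f) :
    varNu α E i f * specProfile α E i (4 / varNu α E i f) ≤ 2 * dirichlet α E i f := by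
  set V := varNu α E i f with hV
  set g : Pt d → ℝ := fun x => max (f x - V / 4) 0 with hg
  set U : Finset (Pt d) := E.filter fun x => V / 4 < f x with hUdef
  have hUE : U ⊆ E := Finset.filter_subset _ _
  have hgle : ∀ x ∈ E, g x ≤ f x := fun x hx => max_le (by linarith) (hf x hx)
  have hgsq : ∀ x ∈ E, f x ^ 2 - 2 * (V / 4) * f x ≤ g x ^ 2 := by
    intro x hx
    have h0 := hf x hx
    simp only [hg]
    rcases le_total (f x - V / 4) 0 with h | h
    · rw [max_eq_right h]; nlinarith
    · rw [max_eq_left h]; nlinarith [sq_nonneg V]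
  have hvarg : V / 2 ≤ varNu α E i g := by
    have h1 : ∑ x ∈ E, nu α E i x * f x ^ 2 - 2 * (V / 4) * ∑ x ∈ E, nu α E i x * f x
        ≤ ∑ x ∈ E, nu α E i x * g x ^ 2 := by
      rw [Finset.mul_sum, ← Finset.sum_sub_distrib]
      refine Finset.sum_le_sum fun x hx => ?_
      have := mul_le_mul_of_nonneg_left (hgsq x hx) (nu_pos hE α i hx).le
      linarith
    have h2 : ∑ x ∈ E, nu α E i x * g x ≤ 1 := by
      rw [← hmean]
      exact Finset.sum_le_sum fun x hx =>
        mul_le_mul_of_nonneg_left (hgle x hx) (nu_pos hE α i hx).le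
    have h3 : 0 ≤ ∑ x ∈ E, nu α E i x * g x :=
      Finset.sum_nonneg fun x hx => mul_nonneg (nu_pos hE α i hx).le (le_max_right _ _)
    have h4 := pow_le_one₀ (n := 2) h3 h2
    have h5 : V = ∑ x ∈ E, nu α E i x * f x ^ 2 - 1 := by rw [hV, varNu, hmean]; ring
    rw [hmean] at h1
    rw [varNu]
    linarith
  have hgc : Nonconst E g := by
    by_contra h
    rw [varNu_eq_zero hE h] at hvarg
    linarith
  have hgU : ∀ x ∈ E, x ∉ U → g x = 0 := by
    intro x hx hxU
    refine max_eq_right ?_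
    by_contra! h
    exact hxU (Finset.mem_filter.2 ⟨hx, by linarith⟩)
  have hUne : U.Nonempty := by
    rw [Finset.nonempty_iff_ne_empty]
    intro h
    obtain ⟨x, hx, y, hy, hxy⟩ := hgc
    rw [hgU x hx (by simp [h]), hgU y hy (by simp [h])] at hxy
    exact hxy rfl
  have hUν : nuSet α E i U ≤ 4 / V := by
    rw [le_div_iff₀ hvar, nuSet]
    have h1 : (∑ x ∈ U, nu α E i x) * (V / 4) ≤ ∑ x ∈ E, nu α E i x * f x := by
      rw [Finset.sum_mul]
      refine (Finset.sum_le_sum fun x hx => ?_).trans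
        (Finset.sum_le_sum_of_subset_of_nonneg hUE fun x hx _ =>
          mul_nonneg (nu_pos hE α i hx).le (hf x hx))
      exact mul_le_mul_of_nonneg_left (Finset.mem_filter.1 hx).2.le (nu_pos hE α i (hUE hx)).le
    linarith
  have hνU := nuStar_le_nuSet (α := α) (i := i) hE hUE hUne
  have hprof : specProfile α E i (4 / V) ≤ lambdaU α E i U :=
    csInf_le (bddBelow_specProfile_set hE _) ⟨U, hUE, hνU, hUν, rfl⟩
  have hquot := hprof.trans (lambdaU_le hE ⟨fun x _ => le_max_right _ _, hgc, hgU⟩)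
  rw [le_div_iff₀ (varNu_pos hE hgc)] at hquot
  have hdir : dirichlet α E i g ≤ dirichlet α E i f := by
    rw [dirichlet_eq hE, dirichlet_eq hE]
    refine mul_le_mul_of_nonneg_left ?_ (by norm_num)
    refine Finset.sum_le_sum fun x _ => Finset.sum_le_sum fun y _ => ?_
    refine mul_le_mul_of_nonneg_left ?_ (div_pos (rate_pos α x y) (Wsum_pos hE α i)).le
    rw [sq_le_sq]
    have h := abs_max_sub_max_le_abs (f x - V / 4) (f y - V / 4) 0
    rwa [sub_sub_sub_cancel_right] at h
  have hpos := specProfile_pos hE (hνU.trans hUν)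
  nlinarith [mul_le_mul_of_nonneg_left hvarg hpos.le]

lemma gen_apply_ne {x y : E} (hxy : x ≠ y) :
    gen α E i x y = rate α (x : Pt d) y / wgt α E i x := by
  simp [gen, hxy]

lemma sum_gen (α : ℝ) (i : ℕ) (x : E) : ∑ y, gen α E i x y = 0 := by
  have h : ∀ y ∈ Finset.univ.erase x, gen α E i x y = rate α (x : Pt d) y / wgt α E i x :=
    fun y hy => gen_apply_ne (Finset.ne_of_mem_erase hy).symm
  have hxx : gen α E i x x = -∑ z ∈ E.erase (x : Pt d), rate α (x : Pt d) z / wgt α E i x := by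
    simp [gen]
  rw [← Finset.add_sum_erase _ _ (Finset.mem_univ x), Finset.sum_congr rfl h, hxx,
    neg_add_eq_zero]
  have h1 := Finset.add_sum_erase E (fun z => rate α (x : Pt d) z / wgt α E i x) x.2
  have h2 := Finset.add_sum_erase Finset.univ
    (fun z : E => rate α (x : Pt d) z / wgt α E i x) (Finset.mem_univ x)
  have h3 := Finset.sum_coe_sort E fun z => rate α (x : Pt d) z / wgt α E i x
  linarith

lemma gen_reversible (hE : 2 ≤ E.card) (x y : E) :
    nu α E i x * gen α E i x y = nu α E i y * gen α E i y x := by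
  by_cases hxy : x = y
  · rw [hxy]
  · rw [gen_apply_ne hxy, gen_apply_ne (Ne.symm hxy), nu_mul_rate_div_wgt hE x.2,
      nu_mul_rate_div_wgt hE y.2, rate_comm]

lemma sum_nu_mul_gen_mul_sq (hE : 2 ≤ E.card) (f : Pt d → ℝ) :
    ∑ x : E, ∑ y : E, nu α E i x * gen α E i x y * (f x - f y) ^ 2
      = 2 * dirichlet α E i f := by
  rw [dirichlet_eq hE, ← mul_assoc, mul_one_div_cancel two_ne_zero, one_mul,
    ← Finset.sum_coe_sort E]
  refine Finset.sum_congr rfl fun x _ => ?_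
  rw [← Finset.sum_coe_sort E]
  refine Finset.sum_congr rfl fun y _ => ?_
  by_cases hxy : x = y
  · simp [hxy]
  · rw [gen_apply_ne hxy, nu_mul_rate_div_wgt hE x.2]

lemma heatKernel_eq_exp (α : ℝ) (i : ℕ) (t : ℝ) (x y : E) :
    heatKernel α E i t x y = NormedSpace.exp (t • gen α E i) x y :=
  (hasSum_exp_smul_apply _ t x y).tsum_eq

end RandomWalk

/-- Lemma 3.1: mixing time bound via the spectral profile. -/
theorem stmt_7 (E : Finset (Pt d)) (hE : 2 ≤ E.card) (α : ℝ) (hα : 0 < α)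
    (i : ℕ) (hi : i ∈ ({1, 2, 3} : Set ℕ)) :
    mixTime α E i ≤ ENNReal.ofReal
      (2 * ∫ r in (4 * nuStar α E i)..(4 * Real.exp 1),
        1 / (r * specProfile α E i r)) := by
  have hν := nuStar_pos hE α i
  have hlt : 4 * nuStar α E i < 4 * Real.exp 1 := by
    have h1 := nuStar_le_one hE α i
    have h2 := Real.one_lt_exp_iff.2 one_pos
    linarith
  have hle : nuStar α E i ≤ 4 * nuStar α E i := by linarith
  have hint := intervalIntegrable_inv_mul_specProfile hE hle hlt.le
  have hprof : ∀ r, 4 * nuStar α E i ≤ r → 0 < specProfile α E i r := fun r hr =>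
    specProfile_pos hE (hle.trans hr)
  have hpos := intervalIntegral.intervalIntegral_pos_of_pos_on hint
    (fun r hr => one_div_pos.2 (mul_pos (by linarith [hr.1]) (hprof r hr.1.le))) hlt
  refine iInf₂_le_of_le _ (mul_pos two_pos hpos) (iInf_le_of_le (fun x y => ?_) le_rfl)
  have hexp : 4 / (4 * Real.exp 1) = Real.exp (-1) := by
    rw [div_mul_cancel_left₀ four_ne_zero, Real.exp_neg]
  rw [heatKernel_eq_exp, ← hexp]
  refine abs_exp_profile_time_sub_div_le (π := fun x : E => nu α E i x)
    (fun x => nu_pos hE α i x.2) ((Finset.sum_coe_sort E _).trans (sum_nu hE α i)) ?_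
    (sum_gen α i) (gen_reversible hE) hν (fun x => nuStar_le_nu x.2) hlt hprof hint ?_ x y
  · intro x y hxy
    rw [gen_apply_ne hxy]
    exact (div_pos (rate_pos _ _ _) (wgt_pos hE α i x.2)).le
  · intro f hf hmean hvar
    set F : Pt d → ℝ := fun p => if h : p ∈ E then f ⟨p, h⟩ else 0 with hF
    have hFf : ∀ x : E, F x = f x := fun x => by simp [hF]
    have hFmean : ∑ x ∈ E, nu α E i x * F x = 1 := by
      rw [← Finset.sum_coe_sort, ← hmean]
      exact Finset.sum_congr rfl fun x _ => by rw [hFf]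
    have hFvar : varNu α E i F = ∑ x : E, nu α E i x * f x ^ 2 - 1 := by
      rw [varNu, hFmean, one_pow, ← Finset.sum_coe_sort]
      congr 1
      exact Finset.sum_congr rfl fun x _ => by rw [hFf]
    have h := varNu_mul_specProfile_le hE (fun x hx => (hf ⟨x, hx⟩).trans_eq (hFf ⟨x, hx⟩).symm)
      hFmean (hFvar ▸ hvar)
    rw [hFvar, ← sum_nu_mul_gen_mul_sq hE] at h
    simpa only [hFf] using h

end
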